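/- Let V be a finite-dimensional real vector space and Φ ⊆ V a finite reduced crystallographic root system spanning V. Let V_0 ⊆ V_1 ⊆ ⋯ ⊆ V_d = V be a chain of linear subspaces and set Φ_i = Φ ∩ V_i for 0 ≤ i ≤ d (so Φ_d = Φ). Then there exists a base Δ of Φ such that for every 0 ≤ i ≤ d the set Δ ∩ Φ_i is a base of the root subsystem Φ_i; that is, every root in Φ ∩ V_i is an integer linear combination of elements of Δ ∩ V_i with coefficients all nonnegative or all nonpositive. (This is the root-system content of Lemma 3.2: a chain of Levi subgroups G^0 ⊊ ⋯ ⊊ G^d = G containing a fixed maximal torus T can be made simultaneously standard with respect to a single Borel subgroup containing T.) -/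

import Mathlib

open RealInnerProductSpace

/-- `Δ` is a base (system of simple roots) of the root system `Ψ` inside the real vector
space `V`: it is a linearly independent subset of `Ψ` such that every root of `Ψ` is an
integer linear combination of elements of `Δ` with coefficients that are all nonnegative
or all nonpositive. -/
def IsRootBase {V : Type*} [AddCommGroup V] [Module ℝ V] (Δ Ψ : Set V) : Prop :=
  Δ ⊆ Ψ ∧ LinearIndependent ℝ (fun a : Δ => (a : V)) ∧
    ∀ β ∈ Ψ, ∃ c : V →₀ ℤ, (c.support : Set V) ⊆ Δ ∧
      β = c.sum (fun a n => (n : ℝ) • a) ∧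
      ((∀ a, 0 ≤ c a) ∨ (∀ a, c a ≤ 0))


theorem aux_sub_mem {V : Type*} [NormedAddCommGroup V] [InnerProductSpace ℝ V]
    (Φ : Set V) (h0 : (0 : V) ∉ Φ)
    (hcrys : ∀ α ∈ Φ, ∀ β ∈ Φ, ∃ n : ℤ, 2 * ⟪β, α⟫ / ⟪α, α⟫ = (n : ℝ))
    (hrefl : ∀ α ∈ Φ, ∀ β ∈ Φ, β - (2 * ⟪β, α⟫ / ⟪α, α⟫) • α ∈ Φ)
    (α β : V) (hα : α ∈ Φ) (hβ : β ∈ Φ) (hne : α ≠ β) (hpos : 0 < ⟪α, β⟫) :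
    α - β ∈ Φ ∨ β - α ∈ Φ := by
  have key : ∀ α β : V, α ∈ Φ → β ∈ Φ → 0 < ⟪β, α⟫ → β - α ∈ Φ ∨ ⟪α, α⟫ ≤ ⟪β, α⟫ := by
    intro α β hα hβ hp
    have haa : 0 < ⟪α, α⟫ := real_inner_self_pos.mpr (fun h => h0 (h ▸ hα))
    obtain ⟨n, hn⟩ := hcrys α hα β hβ
    have hr := hrefl α hα β hβ
    rw [hn] at hr
    have hn0 : (0 : ℝ) < n := by rw [← hn]; positivity
    have hn1 : 0 < n := by exact_mod_cast hn0
    rcases (show n = 1 ∨ 2 ≤ n by omega) with h | h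
    · left; simpa [h] using hr
    · right
      have h2 : (2 : ℝ) ≤ n := by exact_mod_cast h
      rw [← hn, le_div_iff₀ haa] at h2
      linarith
  rcases key β α hβ hα hpos with h | h
  · exact Or.inl h
  rcases key α β hα hβ (by rwa [real_inner_comm]) with h' | h'
  · exact Or.inr h'
  exfalso
  apply hne
  have hcm : ⟪β, α⟫ = ⟪α, β⟫ := real_inner_comm _ _
  have : ⟪α - β, α - β⟫ ≤ 0 := by
    rw [real_inner_sub_sub_self]; linarith
  rw [real_inner_self_nonpos] at this
  exact sub_eq_zero.mp this

theorem aux_neg_mem {V : Type*} [NormedAddCommGroup V] [InnerProductSpace ℝ V]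
    (Φ : Set V) (h0 : (0 : V) ∉ Φ)
    (hrefl : ∀ α ∈ Φ, ∀ β ∈ Φ, β - (2 * ⟪β, α⟫ / ⟪α, α⟫) • α ∈ Φ)
    (α : V) (hα : α ∈ Φ) : -α ∈ Φ := by
  have haa : 0 < ⟪α, α⟫ := real_inner_self_pos.mpr (fun h => h0 (h ▸ hα))
  have := hrefl α hα α hα
  rw [mul_div_assoc, div_self haa.ne', mul_one, two_smul] at this
  simpa using this

theorem aux_kill {V : Type*} [AddCommGroup V] [Module ℝ V]
    (Φ : Set V) (hfin : Φ.Finite) (W : Submodule ℝ V) :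
    ∃ g : V →ₗ[ℝ] ℝ, (∀ x ∈ W, g x = 0) ∧ ∀ β ∈ Φ, β ∉ W → g β ≠ 0 := by
  have : Finite {β : V // β ∈ Φ ∧ β ∉ W} := hfin.subset (t := {β | β ∈ Φ ∧ β ∉ W}) fun x hx => hx.1
  obtain ⟨φ, hφ⟩ := Module.exists_dual_forall_apply_ne_zero (K := ℝ)
    (fun b : {β : V // β ∈ Φ ∧ β ∉ W} => W.mkQ b.1) (fun b => by
      simpa using b.2.2)
  refine ⟨φ ∘ₗ W.mkQ, fun x hx => ?_, fun β h1 h2 => hφ ⟨β, h1, h2⟩⟩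
  have : W.mkQ x = 0 := by simpa using hx
  simp only [LinearMap.comp_apply, this, map_zero]

theorem aux_functional {V : Type*} [AddCommGroup V] [Module ℝ V]
    (Φ : Set V) (hfin : Φ.Finite) (h0 : (0 : V) ∉ Φ)
    (d : ℕ) (Vs : Fin (d + 1) → Submodule ℝ V) (hchain : Monotone Vs) (n : ℕ) :
    ∃ f : V →ₗ[ℝ] ℝ, (∀ β ∈ Φ, f β ≠ 0) ∧
      ∀ i : Fin (d + 1), i.val < n → ∀ α ∈ Φ, α ∈ Vs i → ∀ β ∈ Φ, β ∉ Vs i → |f α| < |f β| := by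
  induction n with
  | zero =>
    obtain ⟨g, -, hg⟩ := aux_kill Φ hfin ⊥
    exact ⟨g, fun β hβ => hg β hβ (by simpa using fun h : β = 0 => h0 (h ▸ hβ)), by simp⟩
  | succ n ih =>
    obtain ⟨f, hf, hfi⟩ := ih
    by_cases hn : n < d + 1
    swap
    · exact ⟨f, hf, fun i _ => hfi i (by omega)⟩
    obtain ⟨g, hg0, hg⟩ := aux_kill Φ hfin (Vs ⟨n, hn⟩)
    have hev : ∀ᶠ N : ℝ in Filter.atTop, ∀ α ∈ Φ, ∀ β ∈ Φ, β ∉ Vs ⟨n, hn⟩ →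
        |f α| < |f β + N * g β| := by
      rw [Filter.eventually_all_finite hfin]
      intro α hα
      rw [Filter.eventually_all_finite hfin]
      intro β hβ
      by_cases hb : β ∈ Vs ⟨n, hn⟩
      · exact Filter.Eventually.of_forall fun N h => absurd hb h
      have hpos : 0 < |g β| := abs_pos.mpr (hg β hβ hb)
      filter_upwards [Filter.eventually_gt_atTop ((|f α| + |f β|) / |g β|),
        Filter.eventually_gt_atTop 0] with N hN hN0 _
      rw [div_lt_iff₀ hpos] at hN
      have h1 : |N * g β| = N * |g β| := by rw [abs_mul, abs_of_pos hN0]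
      have h2 := abs_sub_abs_le_abs_sub (N * g β) (-f β)
      rw [abs_neg, sub_neg_eq_add, add_comm (N * g β)] at h2
      linarith
    obtain ⟨N, hN⟩ := hev.exists
    have hin : ∀ x ∈ Vs ⟨n, hn⟩, (f + N • g) x = f x := fun x hx => by simp [hg0 x hx]
    have hout : ∀ x, (f + N • g) x = f x + N * g x := fun x => by simp
    refine ⟨f + N • g, fun β hβ => ?_, fun i hi α hα hαi β hβ hβi => ?_⟩
    · by_cases hb : β ∈ Vs ⟨n, hn⟩
      · rw [hin β hb]; exact hf β hβ
      · rw [hout]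
        exact abs_pos.mp ((abs_nonneg _).trans_lt (hN β hβ β hβ hb))
    · have hle : Vs i ≤ Vs ⟨n, hn⟩ := hchain (by rw [Fin.le_def]; simp; omega)
      rw [hin α (hle hαi)]
      by_cases hb : β ∈ Vs ⟨n, hn⟩
      · rw [hin β hb]
        have : i.val ≠ n := by
          intro h
          apply hβi
          have : i = ⟨n, hn⟩ := Fin.ext h
          rwa [this]
        exact hfi i (by omega) α hα hαi β hβ hβi
      · rw [hout]; exact hN α hα β hβ hb

theorem aux_comb {V : Type*} [AddCommGroup V] [Module ℝ V] (S : Set V) (β : V)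
    (h : β ∈ AddSubmonoid.closure S) :
    ∃ c : V →₀ ℤ, (c.support : Set V) ⊆ S ∧
      β = c.sum (fun a n => (n : ℝ) • a) ∧ ∀ a, 0 ≤ c a := by
  classical
  induction h using AddSubmonoid.closure_induction with
  | mem x hx =>
    refine ⟨Finsupp.single x 1, ?_, by simp, fun a => ?_⟩
    · intro a ha
      have := Finsupp.support_single_subset ha
      simp at this
      rwa [this]
    · rw [Finsupp.single_apply]; split_ifs <;> simp
  | zero => exact ⟨0, by simp, by simp, by simp⟩
  | add x y _ _ hx hy =>
    obtain ⟨c, h1, h2, h3⟩ := hx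
    obtain ⟨c', h1', h2', h3'⟩ := hy
    refine ⟨c + c', ?_, ?_, fun a => by simpa using add_nonneg (h3 a) (h3' a)⟩
    · intro a ha
      rcases Finset.mem_union.mp (Finsupp.support_add ha) with h | h
      · exact h1 h
      · exact h1' h
    · rw [Finsupp.sum_add_index', ← h2, ← h2']
      · simp
      · intro a m n; push_cast; rw [add_smul]

theorem aux_closure {V : Type*} [AddCommGroup V] [Module ℝ V] (P : Set V) (hP : P.Finite)
    (f : V →ₗ[ℝ] ℝ) (hf : ∀ β ∈ P, 0 < f β) (W : Set V)
    (hW : ∀ α ∈ P, α ∈ W → ∀ β ∈ P, β ∉ W → f α < f β) (β : V) (hβ : β ∈ P) (hβW : β ∈ W) :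
    β ∈ AddSubmonoid.closure ({α | α ∈ P ∧ ¬ ∃ x ∈ P, ∃ y ∈ P, α = x + y} ∩ W) := by
  have hwf : P.WellFoundedOn (fun x y => f x < f y) := by
    have : IsStrictOrder V (fun x y => f x < f y) :=
      { irrefl := fun x => lt_irrefl _, trans := fun x y z h h' => lt_trans h h' }
    exact hP.wellFoundedOn
  revert hβW
  refine hwf.induction (P := fun β => β ∈ W → β ∈ AddSubmonoid.closure
    ({α | α ∈ P ∧ ¬ ∃ x ∈ P, ∃ y ∈ P, α = x + y} ∩ W)) hβ ?_
  · intro β hβ ih hβW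
    by_cases h : ∃ x ∈ P, ∃ y ∈ P, β = x + y
    · obtain ⟨x, hx, y, hy, rfl⟩ := h
      have h1 := hf x hx
      have h2 := hf y hy
      have hs := map_add f x y
      refine add_mem (ih x hx (by linarith) ?_) (ih y hy (by linarith) ?_)
      · by_contra hc
        have := hW _ hβ hβW x hx hc
        linarith
      · by_contra hc
        have := hW _ hβ hβW y hy hc
        linarith
    · exact AddSubmonoid.subset_closure ⟨⟨hβ, h⟩, hβW⟩

/-- Lemma 3.2 (root-system content): given a finite reduced crystallographic root system
`Φ` spanning `V` and a chain of linear subspaces `V_0 ⊆ V_1 ⊆ ⋯ ⊆ V_d = V`, there is a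
base `Δ` of `Φ` such that `Δ ∩ V_i` is a base of the root subsystem `Φ ∩ V_i` for every
`0 ≤ i ≤ d`. -/
theorem exists_simultaneous_base
    {V : Type*} [NormedAddCommGroup V] [InnerProductSpace ℝ V] [FiniteDimensional ℝ V]
    (Φ : Set V) (hfin : Φ.Finite) (h0 : (0 : V) ∉ Φ)
    (hspan : Submodule.span ℝ Φ = ⊤)
    (hreduced : ∀ α ∈ Φ, ∀ t : ℝ, t • α ∈ Φ → t = 1 ∨ t = -1)
    (hcrys : ∀ α ∈ Φ, ∀ β ∈ Φ, ∃ n : ℤ, 2 * ⟪β, α⟫ / ⟪α, α⟫ = (n : ℝ))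
    (hrefl : ∀ α ∈ Φ, ∀ β ∈ Φ, β - (2 * ⟪β, α⟫ / ⟪α, α⟫) • α ∈ Φ)
    (d : ℕ) (Vs : Fin (d + 1) → Submodule ℝ V)
    (hchain : Monotone Vs) (hlast : Vs (Fin.last d) = ⊤) :
    ∃ Δ : Set V, IsRootBase Δ Φ ∧
      ∀ i : Fin (d + 1), IsRootBase (Δ ∩ (Vs i : Set V)) (Φ ∩ (Vs i : Set V)) := by
  obtain ⟨f, hf, hfi⟩ := aux_functional Φ hfin h0 d Vs hchain (d + 1)
  have hneg := aux_neg_mem Φ h0 hrefl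
  set P : Set V := {α | α ∈ Φ ∧ 0 < f α} with hPdef
  have hPfin : P.Finite := hfin.subset fun x hx => hx.1
  set Δ : Set V := {α | α ∈ P ∧ ¬ ∃ x ∈ P, ∃ y ∈ P, α = x + y} with hΔ
  have hli : LinearIndependent ℝ (fun a : Δ => (a : V)) := by
    have : Finite Δ := hPfin.subset fun x hx => hx.1
    have : Fintype Δ := Fintype.ofFinite _
    refine LinearMap.BilinForm.linearIndependent_of_pairwise_le_zero (innerₗ V) ?_ f _
      (fun a => a.2.1.2) ?_
    · intro x hx
      have : 0 < ⟪x, x⟫ := real_inner_self_pos.mpr hx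
      simpa using this
    · rintro ⟨a, ha⟩ ⟨b, hb⟩ hab
      by_contra! hc
      have hab' : a ≠ b := fun h => hab (Subtype.ext h)
      have key : ∀ a b : V, a ∈ Δ → b ∈ Δ → a - b ∈ Φ → False := by
        intro a b ha hb h
        rcases lt_or_gt_of_ne (hf _ h) with h' | h'
        · exact hb.2 ⟨b - a, ⟨by simpa using hneg _ h, by rw [map_sub] at h' ⊢; linarith⟩,
            a, ha.1, by abel⟩
        · exact ha.2 ⟨a - b, ⟨h, h'⟩, b, hb.1, by abel⟩
      rcases aux_sub_mem Φ h0 hcrys hrefl a b ha.1.1 hb.1.1 hab' (by simpa using hc) with h | h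
      · exact key a b ha hb h
      · exact key b a hb ha h
  have main : ∀ i : Fin (d + 1),
      IsRootBase (Δ ∩ (Vs i : Set V)) (Φ ∩ (Vs i : Set V)) := by
    intro i
    refine ⟨fun x hx => ⟨hx.1.1.1, hx.2⟩, LinearIndepOn.mono (v := id) hli Set.inter_subset_left, ?_⟩
    have hc := aux_closure P hPfin f (fun β h => h.2) (Vs i : Set V) (by
      intro α hα hαi β hβ hβi
      have := hfi i i.2 α hα.1 hαi β hβ.1 hβi
      rwa [abs_of_pos hα.2, abs_of_pos hβ.2] at this)
    rintro β ⟨hβ, hβi⟩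
    rcases lt_or_gt_of_ne (hf _ hβ) with h' | h'
    · obtain ⟨c, h1, h2, h3⟩ := aux_comb _ _ (hc (-β) ⟨hneg _ hβ, by simpa using h'⟩
        (by simpa using hβi))
      refine ⟨-c, by rw [Finsupp.support_neg]; exact h1, ?_, Or.inr fun a => by simpa using h3 a⟩
      rw [Finsupp.sum_neg_index (by simp)]
      rw [← neg_neg β, h2]
      simp [Finsupp.sum]
    · obtain ⟨c, h1, h2, h3⟩ := aux_comb _ _ (hc β ⟨hβ, h'⟩ hβi)
      exact ⟨c, h1, h2, Or.inl h3⟩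
  refine ⟨Δ, ?_, main⟩
  have := main (Fin.last d)
  rw [hlast] at this
  simpa using this
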